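/- For every natural number m, Σ_{ℓ=0}^{2m+1} [2m+1,ℓ]_q · (−q)^ℓ = ∏_{t=0}^{m} (1 − q^{2t+1}). (Equivalently, with s_{N|1} := (−1)^N Σ_{ℓ=0}^{N} [N,ℓ]_q (−q)^ℓ, one has s_{2m+1|1} = −∏_{t=0}^{m}(1 − q^{2t+1}).) -/

import Mathlib

/-- The Gaussian (`q`-binomial) coefficient `[n, k]_q`, defined by the recurrence
`[n, 0]_q = 1`, `[0, k+1]_q = 0`, `[n+1, k+1]_q = [n, k]_q + q^(k+1) * [n, k+1]_q`
(so that `[n+1, k]_q = [n, k-1]_q + q^k * [n, k]_q` and `[n, k]_q = 0` for `k > n`). -/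
def qBinom {R : Type*} [CommRing R] (q : R) : ℕ → ℕ → R
  | _, 0 => 1
  | 0, _ + 1 => 0
  | n + 1, k + 1 => qBinom q n k + q ^ (k + 1) * qBinom q n (k + 1)

theorem qBinom_zero_right {R : Type*} [CommRing R] (q : R) (n : ℕ) : qBinom q n 0 = 1 := by
  cases n <;> rfl

theorem qBinom_eq_zero_of_lt {R : Type*} [CommRing R] (q : R) :
    ∀ {n k : ℕ}, n < k → qBinom q n k = 0
  | 0, _ + 1, _ => rfl
  | n + 1, k + 1, h => by
    rw [qBinom, qBinom_eq_zero_of_lt q (Nat.lt_of_succ_lt_succ h),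
      qBinom_eq_zero_of_lt q (Nat.lt_of_succ_lt h), mul_zero, add_zero]

/-- The Rogers–Szegő polynomial `∑_{k=0}^{n} [n,k]_q x^k`. -/
def rogersSzego {R : Type*} [CommRing R] (q : R) (n : ℕ) (x : R) : R :=
  ∑ k ∈ Finset.range (n + 1), qBinom q n k * x ^ k

theorem rogersSzego_zero {R : Type*} [CommRing R] (q x : R) : rogersSzego q 0 x = 1 := by
  simp [rogersSzego, qBinom_zero_right]

theorem rogersSzego_succ {R : Type*} [CommRing R] (q : R) (n : ℕ) (x : R) :
    rogersSzego q (n + 1) x = x * rogersSzego q n x + rogersSzego q n (q * x) := by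
  have h : rogersSzego q n (q * x) =
      ∑ k ∈ Finset.range (n + 1), qBinom q n (k + 1) * (q * x) ^ (k + 1) + 1 := by
    have h' := Finset.sum_range_succ' (fun k => qBinom q n k * (q * x) ^ k) (n + 1)
    rw [Finset.sum_range_succ, qBinom_eq_zero_of_lt q n.lt_succ_self, zero_mul, add_zero] at h'
    simpa [rogersSzego, qBinom_zero_right] using h'
  rw [h, rogersSzego, rogersSzego, Finset.sum_range_succ', Finset.mul_sum, ← add_assoc,
    ← Finset.sum_add_distrib, qBinom_zero_right, pow_zero, mul_one]
  congr 1
  refine Finset.sum_congr rfl fun k _ => ?_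
  rw [qBinom]
  ring

theorem rogersSzego_sub_rogersSzego_mul {R : Type*} [CommRing R] (q : R) (n : ℕ) (x : R) :
    rogersSzego q (n + 1) x - rogersSzego q (n + 1) (q * x) =
      (1 - q ^ (n + 1)) * x * rogersSzego q n x := by
  induction n generalizing x with
  | zero =>
    simp only [rogersSzego_succ, rogersSzego_zero]
    ring
  | succ n ih =>
    linear_combination rogersSzego_succ q (n + 1) x - rogersSzego_succ q (n + 1) (q * x) +
      ih (q * x) + q * x * ih x - q * (1 - q ^ (n + 1)) * x * rogersSzego_succ q n x

theorem rogersSzego_add_two_neg_one {R : Type*} [CommRing R] (q : R) (n : ℕ) :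
    rogersSzego q (n + 2) (-1) = (1 - q ^ (n + 1)) * rogersSzego q n (-1) := by
  linear_combination rogersSzego_succ q (n + 1) (-1) - rogersSzego_sub_rogersSzego_mul q n (-1)

theorem rogersSzego_odd_neg_one {R : Type*} [CommRing R] (q : R) (m : ℕ) :
    rogersSzego q (2 * m + 1) (-1) = 0 := by
  induction m with
  | zero => simp [rogersSzego_succ, rogersSzego_zero]
  | succ m ih => rw [Nat.mul_succ, Nat.add_right_comm, rogersSzego_add_two_neg_one, ih, mul_zero]

theorem rogersSzego_even_neg_one {R : Type*} [CommRing R] (q : R) (m : ℕ) :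
    rogersSzego q (2 * m) (-1) = ∏ t ∈ Finset.range m, (1 - q ^ (2 * t + 1)) := by
  induction m with
  | zero => simp [rogersSzego_zero]
  | succ m ih =>
    rw [Nat.mul_succ, rogersSzego_add_two_neg_one, ih, Finset.prod_range_succ, mul_comm]

/-- `∑_{ℓ=0}^{2m+1} [2m+1,ℓ]_q (-q)^ℓ = ∏_{t=0}^{m} (1 - q^{2t+1})`. -/
theorem gauss_like_sum_odd_shift_one {R : Type*} [CommRing R] (q : R) (m : ℕ) :
    ∑ ℓ ∈ Finset.range (2 * m + 1 + 1), qBinom q (2 * m + 1) ℓ * (-q) ^ ℓ =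
      ∏ t ∈ Finset.range (m + 1), (1 - q ^ (2 * t + 1)) := by
  have h := rogersSzego_succ q (2 * m + 1) (-1)
  rw [rogersSzego_odd_neg_one, mul_zero, zero_add, mul_neg_one] at h
  rw [← rogersSzego_even_neg_one]
  exact h.symm
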